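/- arXiv:2410.00209 — 2 statements merged into one kernel-verified Lean document; each statement's English description precedes it below -/
import Mathlib

section
/- There exists N such that for all n ≥ N the following holds: for every integer i with 2 ≤ i ≤ n/2 and every integer b with 1 ≤ b ≤ (1/3)·log₂ n, if s is a uniformly random binary string of length n, then the probability that s[i..i+b-1] is a closed repeat of s is greater than 1/8. -/
/-- The substring `s[i..j]` of a (1-indexed) string `s` occurs at position `k`,
i.e. `s[k..k+(j-i)] = s[i..j]`. -/
def OccursAt {α : Type*} (s : ℕ → α) (i j k : ℕ) : Prop :=
  ∀ d : ℕ, d ≤ j - i → s (k + d) = s (i + d)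

/-- `s[i'..i'+(j-i)]` is the next occurrence of the non-empty substring `s[i..j]`
of a string `s` of length `n`: it is an occurrence with `i' > i`, it fits in the
string, and `s[i..j]` does not occur at any of the positions `i+1, ..., i'-1`. -/
def IsNextOcc {α : Type*} (s : ℕ → α) (n i j i' : ℕ) : Prop :=
  1 ≤ i ∧ i ≤ j ∧ j ≤ n ∧ i < i' ∧ i' + (j - i) ≤ n ∧ OccursAt s i j i' ∧
    ∀ k, i < k → k < i' → ¬ OccursAt s i j k

/-- `s[i..j]` is a right closed repeat of `s` (of length `n`) whose next
occurrence starts at position `i'`. -/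
def IsRightClosedWith {α : Type*} (s : ℕ → α) (n i j i' : ℕ) : Prop :=
  IsNextOcc s n i j i' ∧ (i' + (j - i) = n ∨ s (j + 1) ≠ s (i' + (j - i) + 1))

/-- `s[i..j]` is a left closed repeat of `s` (of length `n`) whose next
occurrence starts at position `i'`. -/
def IsLeftClosedWith {α : Type*} (s : ℕ → α) (n i j i' : ℕ) : Prop :=
  IsNextOcc s n i j i' ∧ (i = 1 ∨ s (i - 1) ≠ s (i' - 1))

/-- `s[i..j]` is a closed repeat of `s` (of length `n`) whose next occurrence
starts at position `i'`. -/
def IsClosedWith {α : Type*} (s : ℕ → α) (n i j i' : ℕ) : Prop :=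
  IsRightClosedWith s n i j i' ∧ IsLeftClosedWith s n i j i'

/-- `s[i..j]` is a right closed repeat of `s` of length `n`. -/
def IsRightClosedRepeat {α : Type*} (s : ℕ → α) (n i j : ℕ) : Prop :=
  ∃ i', IsRightClosedWith s n i j i'

/-- `s[i..j]` is a left closed repeat of `s` of length `n`. -/
def IsLeftClosedRepeat {α : Type*} (s : ℕ → α) (n i j : ℕ) : Prop :=
  ∃ i', IsLeftClosedWith s n i j i'

/-- `s[i..j]` is a closed repeat of `s` of length `n`. -/
def IsClosedRepeat {α : Type*} (s : ℕ → α) (n i j : ℕ) : Prop :=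
  ∃ i', IsClosedWith s n i j i'

/-- Interpret a binary word `v : Fin n → Bool` as a 1-indexed string `ℕ → Bool`
(positions outside `[1..n]` are irrelevant for the predicates below). -/
def ext (n : ℕ) (v : Fin n → Bool) : ℕ → Bool :=
  fun k => if h : k - 1 < n then v ⟨k - 1, h⟩ else false

/-- The binary word of length `n` spelled by the 1-indexed string `f`. -/
def trunc (n : ℕ) (f : ℕ → Bool) : Fin n → Bool := fun x => f (x + 1)

theorem ext_trunc {n k : ℕ} (f : ℕ → Bool) (h1 : 1 ≤ k) (h2 : k ≤ n) :
    ext n (trunc n f) k = f k := by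
  have h : k - 1 < n := by omega
  simp only [ext, trunc, h, dif_pos]
  congr 1
  omega

theorem eq_of_ext_eq {n : ℕ} {v w : Fin n → Bool}
    (h : ∀ k, 1 ≤ k → k ≤ n → ext n v k = ext n w k) : v = w := by
  funext x
  simpa [ext] using h (x + 1) (by omega) (by omega)

theorem IsNextOcc.unique {α : Type*} {s : ℕ → α} {n i j p q : ℕ}
    (hp : IsNextOcc s n i j p) (hq : IsNextOcc s n i j q) : p = q := by
  obtain ⟨-, -, -, hp1, -, hp2, hp3⟩ := hp
  obtain ⟨-, -, -, hq1, -, hq2, hq3⟩ := hq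
  rcases lt_trichotomy p q with h | h | h
  · exact absurd hp2 (hq3 p hp1 h)
  · exact h
  · exact absurd hq2 (hp3 q hq1 h)

theorem IsNextOcc.congr {α : Type*} {s t : ℕ → α} {n i j p : ℕ}
    (hp : IsNextOcc s n i j p) (h : ∀ k, i ≤ k → k ≤ p + (j - i) → t k = s k) :
    IsNextOcc t n i j p := by
  obtain ⟨h1, h2, h3, h4, h5, h6, h7⟩ := hp
  refine ⟨h1, h2, h3, h4, h5, fun d hd => ?_, fun k hk1 hk2 hk => h7 k hk1 hk2 fun d hd => ?_⟩
  · rw [h _ (by omega) (by omega), h _ (by omega) (by omega)]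
    exact h6 d hd
  · rw [← h (k + d) (by omega) (by omega), ← h (i + d) (by omega) (by omega)]
    exact hk d hd

theorem exists_isNextOcc {α : Type*} {s : ℕ → α} {n i j p : ℕ} (hi : 1 ≤ i) (hij : i ≤ j)
    (hj : j ≤ n) (hip : i < p) (hp : p + (j - i) ≤ n) (hocc : OccursAt s i j p) :
    ∃ q, IsNextOcc s n i j q := by
  classical
  have hex : ∃ q, i < q ∧ OccursAt s i j q := ⟨p, hip, hocc⟩
  have hle : Nat.find hex ≤ p := Nat.find_min' hex ⟨hip, hocc⟩
  exact ⟨Nat.find hex, hi, hij, hj, (Nat.find_spec hex).1, by omega, (Nat.find_spec hex).2,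
    fun k hk1 hk2 hk => Nat.find_min hex hk2 ⟨hk1, hk⟩⟩

/-- Set the letter before `s[i..j]` and the letter after its occurrence at `p` so that they
differ from their counterparts. -/
def closeAt (s : ℕ → Bool) (i j p : ℕ) : ℕ → Bool := fun k =>
  if k = i - 1 then !s (p - 1) else if k = p + (j - i) + 1 then !s (j + 1) else s k

theorem isClosedWith_trunc_closeAt {n i j p : ℕ} (v : Fin n → Bool) (hi : 2 ≤ i)
    (hp : IsNextOcc (ext n v) n i j p) :
    IsClosedWith (ext n (trunc n (closeAt (ext n v) i j p))) n i j p := by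
  have hp' : IsNextOcc (ext n (trunc n (closeAt (ext n v) i j p))) n i j p := by
    have h5 := hp.2.2.2.2.1
    refine hp.congr fun k hk1 hk2 => ?_
    rw [ext_trunc _ (by omega) (by omega), closeAt, if_neg (by omega), if_neg (by omega)]
  obtain ⟨h1, h2, h3, h4, h5, -⟩ := hp
  refine ⟨⟨hp', ?_⟩, hp', Or.inr ?_⟩
  · by_cases hn : p + (j - i) = n
    · exact Or.inl hn
    · right
      rw [ext_trunc _ (by omega) (by omega), ext_trunc _ (by omega) (by omega), closeAt, closeAt,
        if_neg (by omega), if_neg (by omega), if_neg (by omega), if_pos rfl]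
      simp
  · rw [ext_trunc _ (by omega) (by omega), ext_trunc _ (by omega) (by omega), closeAt, closeAt,
      if_pos rfl, if_neg (by omega), if_neg (by omega)]
    simp

/-- At least a quarter of the words in which `s[i..j]` has a next occurrence have it as a closed
repeat. -/
theorem card_isNextOcc_le {n i j : ℕ} (hi : 2 ≤ i) :
    Nat.card {v : Fin n → Bool // ∃ p, IsNextOcc (ext n v) n i j p} ≤
      4 * Nat.card {v : Fin n → Bool // IsClosedRepeat (ext n v) n i j} := by
  choose p hp using fun v : {v : Fin n → Bool // ∃ p, IsNextOcc (ext n v) n i j p} => v.2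
  have hclosed := fun v => isClosedWith_trunc_closeAt v.1 hi (hp v)
  have hinj : Function.Injective
      (fun v => ((⟨_, p v, hclosed v⟩, ext n v.1 (i - 1), ext n v.1 (p v + (j - i) + 1)) :
        {v : Fin n → Bool // IsClosedRepeat (ext n v) n i j} × Bool × Bool)) := by
    intro v w hvw
    simp only [Prod.mk.injEq] at hvw
    obtain ⟨h1, h2, h3⟩ := hvw
    replace h1 := congrArg Subtype.val h1
    dsimp only at h1
    have hpq : p v = p w := by
      have hv := (hclosed v).1.1
      rw [h1] at hv
      exact hv.unique (hclosed w).1.1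
    refine Subtype.ext (eq_of_ext_eq fun k hk1 hk2 => ?_)
    have hk := congrArg (fun u => ext n u k) h1
    simp only [ext_trunc _ hk1 hk2, closeAt, ← hpq] at hk
    by_cases ha : k = i - 1
    · rw [ha, h2]
    by_cases hb : k = p v + (j - i) + 1
    · rw [hb, h3, hpq]
    · simpa [ha, hb] using hk
  have := Nat.card_le_card_of_injective _ hinj
  simp only [Nat.card_prod, Nat.card_eq_fintype_card (α := Bool), Fintype.card_bool] at this
  omega

/-- Overwrite the `b` letters of `s` from position `p` on by those from position `i` on. -/
def copyBlock (s : ℕ → Bool) (i b p : ℕ) : ℕ → Bool := fun k =>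
  if p ≤ k ∧ k < p + b then s (k - p + i) else s k

/-- Words without a later occurrence of `s[i..i+b-1]` are rare: overwriting any one of `m`
disjoint later blocks by a copy of `s[i..i+b-1]` can be undone from the overwritten letters. -/
theorem mul_card_not_isNextOcc_le {n i b m : ℕ} (hi : 1 ≤ i) (hb : 1 ≤ b)
    (hm : i + b * (m + 1) ≤ n + 1) :
    Nat.card {v : Fin n → Bool // ¬ ∃ p, IsNextOcc (ext n v) n i (i + b - 1) p} * m ≤
      2 ^ n * 2 ^ b := by
  have hpos : ∀ t : Fin m, i + b ≤ i + b * (t + 1) ∧ i + b * (t + 1) + b ≤ n + 1 := by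
    intro t
    have h1 : b * (t + 1 + 1) ≤ b * (m + 1) := Nat.mul_le_mul_left _ (by omega)
    have h2 : b * 1 ≤ b * (t + 1) := Nat.mul_le_mul_left _ (by omega)
    rw [mul_add b (t + 1)] at h1
    omega
  have hdisj : ∀ t u : Fin m, t ≠ u →
      i + b * (t + 1) + b ≤ i + b * (u + 1) ∨ i + b * (u + 1) + b ≤ i + b * (t + 1) := by
    have key : ∀ t u : Fin m, t < u → i + b * (t + 1) + b ≤ i + b * (u + 1) := by
      intro t u h
      have h1 : b * (t + 1 + 1) ≤ b * (u + 1) := Nat.mul_le_mul_left _ (by omega)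
      rw [mul_add b (t + 1)] at h1
      omega
    intro t u h
    rcases lt_or_gt_of_ne h with h | h
    · exact Or.inl (key t u h)
    · exact Or.inr (key u t h)
  have hinj : Function.Injective
      (fun x : {v : Fin n → Bool // ¬ ∃ p, IsNextOcc (ext n v) n i (i + b - 1) p} × Fin m =>
        ((trunc n (copyBlock (ext n x.1.1) i b (i + b * (x.2 + 1))),
          fun d => ext n x.1.1 (i + b * (x.2 + 1) + d)) :
        (Fin n → Bool) × (Fin b → Bool))) := by
    rintro ⟨⟨v, hv⟩, t⟩ ⟨⟨w, hw⟩, u⟩ h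
    simp only [Prod.mk.injEq] at h
    obtain ⟨h1, h2⟩ := h
    have hk : ∀ k, 1 ≤ k → k ≤ n → copyBlock (ext n v) i b (i + b * (t + 1)) k =
        copyBlock (ext n w) i b (i + b * (u + 1)) k := by
      intro k hk1 hk2
      have := congrArg (fun z => ext n z k) h1
      simpa only [ext_trunc _ hk1 hk2] using this
    have ht := hpos t
    have hu := hpos u
    have htu : t = u := by
      by_contra hne
      have hd := hdisj t u hne
      refine hw (exists_isNextOcc (p := i + b * (t + 1)) hi (by omega) (by omega) (by omega)
        (by omega) fun d hd' => ?_)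
      have e1 := hk (i + b * (t + 1) + d) (by omega) (by omega)
      have e2 := hk (i + d) (by omega) (by omega)
      rw [copyBlock, copyBlock, if_pos (by omega), if_neg (by omega)] at e1
      rw [copyBlock, copyBlock, if_neg (by omega), if_neg (by omega)] at e2
      rw [← e1, ← e2]
      congr 1
      omega
    subst htu
    have hvw : v = w := by
      refine eq_of_ext_eq fun k hk1 hk2 => ?_
      by_cases hkt : i + b * (t + 1) ≤ k ∧ k < i + b * (t + 1) + b
      · have := congrFun h2 ⟨k - (i + b * (t + 1)), by omega⟩
        simpa [Nat.add_sub_cancel' hkt.1] using this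
      · simpa only [copyBlock, if_neg hkt] using hk k hk1 hk2
    subst hvw
    rfl
  have := Nat.card_le_card_of_injective _ hinj
  simpa [Nat.card_prod] using this

theorem eight_pow_le_of_le_logb {n b : ℕ} (hn : 0 < n)
    (h : (b : ℝ) ≤ (1 / 3) * Real.logb 2 n) : 8 ^ b ≤ n := by
  have h1 : ((3 * b : ℕ) : ℝ) ≤ Real.logb 2 n := by
    push_cast
    linarith
  rw [Real.le_logb_iff_rpow_le (by norm_num) (by positivity), Real.rpow_natCast, pow_mul] at h1
  norm_num at h1
  exact_mod_cast h1

/-- There is room for more than `2 * 2 ^ b` disjoint blocks of length `b` in the second half of a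
word of length `n ≥ 8 ^ b`. -/
theorem block_room {n i b : ℕ} (hn : 1000 ≤ n) (hi : 2 * i ≤ n) (hb : 8 ^ b ≤ n) :
    i + b * (2 * 2 ^ b + 1 + 1) ≤ n + 1 := by
  have hlt : b ≤ 2 ^ b := Nat.lt_two_pow_self.le
  have h8 : (8 : ℕ) ^ b = 2 ^ b * (2 ^ b * 2 ^ b) := by
    rw [← mul_pow, ← mul_pow]
    norm_num
  rw [h8] at hb
  have h1 : 1 ≤ 2 ^ b := Nat.one_le_two_pow
  generalize 2 ^ b = x at *
  have h2 : b * (2 * x + 1 + 1) ≤ x * (2 * x + 1 + 1) := Nat.mul_le_mul_right _ hlt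
  have h3 : x * (4 * x + 4) ≤ n := by
    rcases le_or_gt x 7 with hx | hx
    · nlinarith
    · nlinarith [Nat.mul_le_mul_right (x * x) hx, Nat.mul_le_mul_right x hx]
  nlinarith

/-- For all large enough `n`: for every `2 ≤ i ≤ n/2` and `1 ≤ b ≤ (1/3)·log₂ n`,
the probability that `s[i..i+b-1]` is a closed repeat of a uniformly random
binary string `s` of length `n` is greater than `1/8`. -/
theorem statement2 :
    ∃ N : ℕ, ∀ n : ℕ, N ≤ n → ∀ i b : ℕ,
      2 ≤ i → (i : ℝ) ≤ (n : ℝ) / 2 → 1 ≤ b → (b : ℝ) ≤ (1 / 3) * Real.logb 2 n →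
      (1 : ℝ) / 8 <
        (Nat.card {v : Fin n → Bool // IsClosedRepeat (ext n v) n i (i + b - 1)} : ℝ)
          / 2 ^ n := by
  refine ⟨1000, fun n hn i b hi hin hb hlog => ?_⟩
  have hi2 : 2 * i ≤ n := by
    have : (2 : ℝ) * i ≤ n := by linarith
    exact_mod_cast this
  have hroom := block_room hn hi2 (eight_pow_le_of_le_logb (by omega) hlog)
  have hbad := mul_card_not_isNextOcc_le (by omega) hb hroom
  have hgood := card_isNextOcc_le (n := n) (j := i + b - 1) hi
  have hsum : Nat.card {v : Fin n → Bool // ∃ p, IsNextOcc (ext n v) n i (i + b - 1) p} +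
      Nat.card {v : Fin n → Bool // ¬ ∃ p, IsNextOcc (ext n v) n i (i + b - 1) p} = 2 ^ n := by
    classical
    rw [← Nat.card_sum, Nat.card_congr (Equiv.sumCompl _)]
    simp
  have hhalf : 2 * Nat.card
      {v : Fin n → Bool // ¬ ∃ p, IsNextOcc (ext n v) n i (i + b - 1) p} < 2 ^ n := by
    by_contra hlt
    have hge := not_lt.mp hlt
    have h1 : 0 < 2 ^ n := Nat.two_pow_pos n
    nlinarith [Nat.mul_le_mul_right (2 ^ b) hge]
  have hfin : 2 ^ n < 8 * Nat.card
      {v : Fin n → Bool // IsClosedRepeat (ext n v) n i (i + b - 1)} := by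
    omega
  have hreal : (2 : ℝ) ^ n < 8 * (Nat.card
      {v : Fin n → Bool // IsClosedRepeat (ext n v) n i (i + b - 1)} : ℝ) := by
    exact_mod_cast hfin
  rw [lt_div_iff₀ (by positivity)]
  linarith
end

section
/- Let s[i..i+t₁-1], s[i..i+t₂-1], s[i..i+t₃-1], s[i..i+t₄-1], s[i..i+t₅-1] be right closed repeats of s starting at the same position i with t₁ < t₂ < t₃ < t₄ < t₅, and let their next occurrences start at positions q₁, q₂, q₃, q₄, q₅ respectively. Then q₅ > q₁ + t₁ + t₃. -/
/-- Next occurrences of right closed repeats starting at the same position move strictly to the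
right as the length grows. -/
theorem IsRightClosedWith.lt_of_lt {α : Type*} {s : ℕ → α} {n i j k p q : ℕ}
    (hj : IsRightClosedWith s n i j p) (hk : IsRightClosedWith s n i k q) (hjk : j < k) :
    p < q := by
  obtain ⟨⟨-, hij, -, -, -, -, hmin⟩, hend⟩ := hj
  obtain ⟨⟨-, -, -, hiq, hqn, hocc, -⟩, -⟩ := hk
  rcases lt_trichotomy p q with h | rfl | h
  · exact h
  · rcases hend with hend | hend
    · omega
    · have e := hocc (j - i + 1) (by omega)
      rw [show i + (j - i + 1) = j + 1 by omega, ← add_assoc] at e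
      exact absurd e.symm hend
  · exact absurd (fun d hd => hocc d (by omega)) (hmin q hiq h)

/-- Among three right closed repeats starting at the same position, the next occurrence of the
longest one starts strictly after the position following the next occurrence of the shortest. -/
theorem IsRightClosedWith.add_lt_of_lt_of_lt {α : Type*} {s : ℕ → α} {n i j k l p q r : ℕ}
    (hj : IsRightClosedWith s n i j p) (hk : IsRightClosedWith s n i k q)
    (hl : IsRightClosedWith s n i l r) (hjk : j < k) (hkl : k < l) :
    p + (j - i) + 1 < r := by
  have hpq := hj.lt_of_lt hk hjk
  have hqr := hk.lt_of_lt hl hkl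
  obtain ⟨⟨-, hij, -, -, -, hoj, -⟩, hend⟩ := hj
  obtain ⟨⟨-, -, -, -, hqn, hok, -⟩, -⟩ := hk
  obtain ⟨⟨-, -, -, -, -, hol, -⟩, -⟩ := hl
  by_contra! hr
  have hne : s (j + 1) ≠ s (p + (j - i) + 1) := hend.resolve_left (by omega)
  obtain ⟨f, rfl⟩ := Nat.exists_eq_add_of_lt hqr
  obtain ⟨d, rfl⟩ := Nat.exists_eq_add_of_lt hpq
  obtain ⟨g, hg⟩ := Nat.exists_eq_add_of_le hr
  obtain ⟨t, rfl⟩ := Nat.exists_eq_add_of_le hij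
  obtain rfl : t = d + f + g + 1 := by omega
  have e₁ := hol g (by omega)
  have e₂ := hok (d + f + g + 2) (by omega)
  have e₃ := hol (d + g + 1) (by omega)
  have e₄ := hoj (d + g + 1) (by omega)
  have e₅ := hok g (by omega)
  apply hne
  grind

/-- If five right closed repeats of lengths `t₁ < t₂ < t₃ < t₄ < t₅` start at
the same position `i` and have next occurrences starting at `q₁, ..., q₅`
respectively, then `q₅ > q₁ + t₁ + t₃`. -/
theorem statement7 {α : Type*} (s : ℕ → α) (n i t₁ t₂ t₃ t₄ t₅ q₁ q₂ q₃ q₄ q₅ : ℕ)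
    (ht : 1 ≤ t₁)
    (h1 : IsRightClosedWith s n i (i + t₁ - 1) q₁)
    (h2 : IsRightClosedWith s n i (i + t₂ - 1) q₂)
    (h3 : IsRightClosedWith s n i (i + t₃ - 1) q₃)
    (h4 : IsRightClosedWith s n i (i + t₄ - 1) q₄)
    (h5 : IsRightClosedWith s n i (i + t₅ - 1) q₅)
    (h12 : t₁ < t₂) (h23 : t₂ < t₃) (h34 : t₃ < t₄) (h45 : t₄ < t₅) :
    q₁ + t₁ + t₃ < q₅ := by
  have h13 := h1.add_lt_of_lt_of_lt h2 h3 (by omega) (by omega)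
  have h35 := h3.add_lt_of_lt_of_lt h4 h5 (by omega) (by omega)
  omega
end
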